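/- arXiv:2604.12689 — 2 statements merged into one kernel-verified Lean document; each statement's English description precedes it below -/
import Mathlib

section
/- Let (a_ε)_ε be a uniform family of homogenization kernels and let (u_ε)_ε be a sequence in C^∞([0,1]) with sup_ε F_ε^{a_ε}(u_ε) < +∞. Then for every λ₁ < λ₂ with [λ₁,λ₂] ∩ {−1,+1} = ∅, there exists N ∈ ℕ, independent of ε, such that for every ε the number of pairwise disjoint transition intervals of u_ε between λ₁ and λ₂ contained in (0,1) is at most N. -/
open MeasureTheory Filter Set Topology
open scoped ENNReal NNReal

noncomputable section

/-- A double-well potential with constants `αW ≤ βW`. -/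
structure IsDoubleWell (W : ℝ → ℝ) (αW βW : ℝ) : Prop where
  continuous : Continuous W
  alpha_pos : 0 < αW
  alpha_le_beta : αW ≤ βW
  lower : ∀ z : ℝ, |z| ≤ 2 → αW * (1 - |z|) ^ 2 ≤ W z
  upper : ∀ z : ℝ, |z| ≤ 2 → W z ≤ βW * (1 - |z|) ^ 2
  far_pos : ∃ c : ℝ, 0 < c ∧ ∀ z : ℝ, 2 ≤ |z| → c ≤ W z

/-- A homogenization kernel with essential bounds `0 < αa`, `βa < ∞`. -/
structure IsHomKernel (a : ℝ × ℝ → ℝ) (αa βa : ℝ) : Prop where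
  measurable : Measurable a
  periodic_fst : ∀ x y : ℝ, a (x + 1, y) = a (x, y)
  periodic_snd : ∀ x y : ℝ, a (x, y + 1) = a (x, y)
  alpha_pos : 0 < αa
  bounds : ∀ᵐ p : ℝ × ℝ ∂volume, αa ≤ a p ∧ a p ≤ βa

/-- Squared Gagliardo seminorm of order `k + s` of `v` on `I`
(computed on the `k`-th derivative of `v`). -/
def gagliardo2 (k : ℕ) (s : ℝ) (I : Set ℝ) (v : ℝ → ℝ) : ℝ≥0∞ :=
  ∫⁻ p in I ×ˢ I, ENNReal.ofReal
    (|iteratedDeriv k v p.1 - iteratedDeriv k v p.2| ^ 2 / |p.1 - p.2| ^ (1 + 2 * s))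

/-- Membership in the fractional Sobolev space `H^{k+s}(I)`. -/
def MemHks (k : ℕ) (s : ℝ) (I : Set ℝ) (u : ℝ → ℝ) : Prop :=
  (∀ j ≤ k, MemLp (iteratedDeriv j u) 2 (volume.restrict I)) ∧
    gagliardo2 k s I u < ⊤

/-- Membership in `H^{k+s}_loc(ℝ)`. -/
def MemHksLoc (k : ℕ) (s : ℝ) (u : ℝ → ℝ) : Prop :=
  ∀ R : ℝ, 0 < R → MemHks k s (Set.Ioo (-R) R) u

/-- The rescaled (modulated) energy `Φ^b(v, I)` with kernel `b`. -/
def Phi (W : ℝ → ℝ) (k : ℕ) (s : ℝ) (b : ℝ × ℝ → ℝ) (I : Set ℝ) (v : ℝ → ℝ) : ℝ≥0∞ :=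
  (∫⁻ x in I, ENNReal.ofReal (W (v x))) +
    ∫⁻ p in I ×ˢ I, ENNReal.ofReal
      (b p * |iteratedDeriv k v p.1 - iteratedDeriv k v p.2| ^ 2 / |p.1 - p.2| ^ (1 + 2 * s))

/-- The scaled Cahn--Hilliard-type energy `F_ε^{a}(u)` on `(0,1)` with kernel `a`. -/
def Fen (W : ℝ → ℝ) (k : ℕ) (s : ℝ) (a : ℝ × ℝ → ℝ) (ε : ℝ) (u : ℝ → ℝ) : ℝ≥0∞ :=
  ENNReal.ofReal (1 / ε) * (∫⁻ x in Set.Ioo (0:ℝ) 1, ENNReal.ofReal (W (u x))) +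
    ENNReal.ofReal (ε ^ (2 * ((k : ℝ) + s) - 1)) *
      ∫⁻ p in (Set.Ioo (0:ℝ) 1) ×ˢ (Set.Ioo (0:ℝ) 1), ENNReal.ofReal
        (a p * |iteratedDeriv k u p.1 - iteratedDeriv k u p.2| ^ 2 / |p.1 - p.2| ^ (1 + 2 * s))

/-- The rescaled kernel `(x, y) ↦ a (x/δ, y/δ)`. -/
def rescKer (a : ℝ × ℝ → ℝ) (δ : ℝ) : ℝ × ℝ → ℝ := fun p => a (p.1 / δ, p.2 / δ)

/-- The oscillating energy `F_{ε,δ}(u)`. -/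
def Feps (W : ℝ → ℝ) (k : ℕ) (s : ℝ) (a : ℝ × ℝ → ℝ) (ε δ : ℝ) (u : ℝ → ℝ) : ℝ≥0∞ :=
  Fen W k s (rescKer a δ) ε u

/-- Transition energy at infinite length, `m^ω(b)`. -/
def mInfLen (W : ℝ → ℝ) (k : ℕ) (s : ℝ) (b : ℝ × ℝ → ℝ) (ω : ℝ) : ℝ≥0∞ :=
  ⨅ v ∈ {v : ℝ → ℝ | MemHksLoc k s v ∧
      Tendsto v atTop (𝓝 ω) ∧ Tendsto v atBot (𝓝 (-ω))},
    Phi W k s b Set.univ v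

/-- Transition energy at finite length `T`, `m^ω(b, T)`. -/
def mFinLen (W : ℝ → ℝ) (k : ℕ) (s : ℝ) (b : ℝ × ℝ → ℝ) (ω : ℝ) (T : ℝ) : ℝ≥0∞ :=
  ⨅ v ∈ {v : ℝ → ℝ | MemHksLoc k s v ∧ ∀ x : ℝ, T < |x| → v x = ω * Real.sign x},
    Phi W k s b Set.univ v

/-- `m^ω_λ(a)` for `λ ∈ (0,∞)`. -/
def mLam (W : ℝ → ℝ) (k : ℕ) (s : ℝ) (a : ℝ × ℝ → ℝ) (ω lam : ℝ) : ℝ≥0∞ :=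
  mInfLen W k s (rescKer a lam) ω

/-- `m^ω_0(a)`: transition energy for the constant kernel `ā = ∬_{(0,1)²} a`. -/
def mZero (W : ℝ → ℝ) (k : ℕ) (s : ℝ) (a : ℝ × ℝ → ℝ) (ω : ℝ) : ℝ≥0∞ :=
  mInfLen W k s (fun _ => ∫ p in (Set.Ioo (0:ℝ) 1) ×ˢ (Set.Ioo (0:ℝ) 1), a p) ω

/-- `m^ω_∞(a)`: transition energy for the constant kernel `a_inf = inf_t a(t,t)`. -/
def mInfty (W : ℝ → ℝ) (k : ℕ) (s : ℝ) (a : ℝ × ℝ → ℝ) (ω : ℝ) : ℝ≥0∞ :=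
  mInfLen W k s (fun _ => ⨅ t : ℝ, a (t, t)) ω

/-- `m^ω_λ(a)` for `λ ∈ [0,∞)`. -/
def mOf (W : ℝ → ℝ) (k : ℕ) (s : ℝ) (a : ℝ × ℝ → ℝ) (ω lam : ℝ) : ℝ≥0∞ :=
  if lam = 0 then mZero W k s a ω else mLam W k s a ω lam

/-- `u : (0,1) → {±1}` is piecewise constant with jump points `t 1 < … < t M` and
values `sg i` on `(t i, t (i+1))`; consecutive values alternate, so every `t i`,
`1 ≤ i ≤ M`, is a genuine jump point. -/
def IsPCRep (u : ℝ → ℝ) (M : ℕ) (t : ℕ → ℝ) (sg : ℕ → ℝ) : Prop :=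
  t 0 = 0 ∧ t (M + 1) = 1 ∧ (∀ i ≤ M, t i < t (i + 1)) ∧
    (∀ i ≤ M, sg i = 1 ∨ sg i = -1) ∧
    (∀ i < M, sg (i + 1) = -sg i) ∧
    ∀ i ≤ M, ∀ x ∈ Set.Ioo (t i) (t (i + 1)), u x = sg i

/-- Number of jumps in direction `ω` (the jump at `t (i+1)` has direction `sg (i+1)`). -/
def jumpCount (M : ℕ) (sg : ℕ → ℝ) (ω : ℝ) : ℕ :=
  {i : ℕ | i < M ∧ sg (i + 1) = ω}.ncard

end


open Polynomial in
lemma aux_antideriv (d : ℕ) (P : ℝ[X]) (hP : P.natDegree ≤ d) :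
    ∃ Q : ℝ[X], Q.natDegree ≤ d + 1 ∧ derivative Q = P := by
  refine ⟨∑ i ∈ Finset.range (d + 1), monomial (i + 1) (P.coeff i / (i + 1)), ?_, ?_⟩
  · apply natDegree_sum_le_of_forall_le
    intro i hi
    refine (natDegree_monomial_le _).trans ?_
    have := Finset.mem_range.1 hi
    omega
  · rw [derivative_sum]
    conv_rhs => rw [P.as_sum_range_C_mul_X_pow' (n := d + 1) (by omega)]
    apply Finset.sum_congr rfl
    intro i hi
    rw [derivative_monomial, C_mul_X_pow_eq_monomial]
    congr 1
    push_cast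
    have : (i : ℝ) + 1 ≠ 0 := by positivity
    field_simp

open Polynomial in
lemma aux_lagrange (k : ℕ) (P : ℝ[X]) (hP : P.natDegree ≤ k) (A L R δ : ℝ) (hL : 0 < L)
    (hR : 1 ≤ R)
    (ι : Type) [DecidableEq ι] (S : Finset ι) (hS : S.card = k + 1) (v : ι → ℝ)
    (hv : ∀ i ∈ S, v i ∈ Set.Icc A (A + L))
    (hsep : ∀ i ∈ S, ∀ j ∈ S, i ≠ j → L ≤ R * |v i - v j|)
    (w : ℝ) (hw : ∀ i ∈ S, |P.eval (v i) - w| ≤ δ) :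
    ∀ x ∈ Set.Icc A (A + L), |P.eval x - w| ≤ (k + 1) * R ^ k * δ := by
  intro x hx
  have hinj : Set.InjOn v S := by
    intro i hi j hj hij
    by_contra hne
    have := hsep i hi j hj hne
    simp [hij] at this
    linarith
  have hdeg : (P - C w).degree < S.card := by
    rw [hS]
    refine lt_of_le_of_lt (degree_le_natDegree) ?_
    have : (P - C w).natDegree ≤ k := by
      refine (natDegree_sub_le _ _).trans ?_
      simp [hP]
    exact_mod_cast Nat.lt_succ_of_le this
  have h := Lagrange.eq_interpolate hinj hdeg
  have h2 : P.eval x - w = ∑ i ∈ S, (P.eval (v i) - w) * (Lagrange.basis S v i).eval x := by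
    have := congrArg (eval x) h
    rw [Lagrange.interpolate_apply, eval_finsetSum] at this
    simpa using this
  rw [h2]
  have hb : ∀ i ∈ S, |(Lagrange.basis S v i).eval x| ≤ R ^ k := by
    intro i hi
    rw [Lagrange.basis, eval_prod, Finset.abs_prod]
    have : R ^ k = ∏ j ∈ S.erase i, R := by
      rw [Finset.prod_const, Finset.card_erase_of_mem hi, hS]; simp
    rw [this]
    apply Finset.prod_le_prod
    · intros; positivity
    · intro j hj
      obtain ⟨hne, hj⟩ := Finset.mem_erase.1 hj
      simp only [Lagrange.basisDivisor, eval_mul, eval_C, eval_sub, eval_X, abs_mul, abs_inv]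
      have h1 := hsep i hi j hj (Ne.symm hne)
      have h3 : 0 < |v i - v j| := by
        by_contra h0
        have : |v i - v j| = 0 := le_antisymm (not_lt.1 h0) (abs_nonneg _)
        rw [this] at h1; linarith
      have h4 : |x - v j| ≤ L := by
        have := hv j hj
        rw [abs_le]; constructor <;> linarith [hx.1, hx.2, this.1, this.2]
      rw [inv_mul_le_iff₀ h3]
      linarith
  calc |∑ i ∈ S, (P.eval (v i) - w) * (Lagrange.basis S v i).eval x|
      ≤ ∑ i ∈ S, |(P.eval (v i) - w) * (Lagrange.basis S v i).eval x| := Finset.abs_sum_le_sum_abs _ _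
    _ ≤ ∑ i ∈ S, R ^ k * δ := by
        apply Finset.sum_le_sum
        intro i hi
        rw [abs_mul, mul_comm]
        exact mul_le_mul (hb i hi) (hw i hi) (abs_nonneg _) (by positivity)
    _ = _ := by rw [Finset.sum_const, hS]; simp; ring

open Polynomial in
lemma aux_poly_trans (k : ℕ) (P : ℝ[X]) (hP : P.natDegree ≤ k) (m : ℝ)
    (p q : Fin (k + 1) → ℝ) (hpq : ∀ i, p i < q i)
    (hd : ∀ i j, i ≠ j → Disjoint (Set.Ioo (p i) (q i)) (Set.Ioo (p j) (q j)))
    (h : ∀ i, (P.eval (p i) < m ∧ m < P.eval (q i)) ∨ (P.eval (q i) < m ∧ m < P.eval (p i))) :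
    False := by
  have hx : ∀ i, ∃ x ∈ Set.Ioo (p i) (q i), P.eval x = m := by
    intro i
    have hc : ContinuousOn (fun x => P.eval x) (Set.Icc (p i) (q i)) := P.continuous.continuousOn
    rcases h i with h | h
    · exact intermediate_value_Ioo (hpq i).le hc h
    · exact intermediate_value_Ioo' (hpq i).le hc h
  choose x hx1 hx2 using hx
  have hinj : Function.Injective x := by
    intro i j hij
    by_contra hne
    exact Set.disjoint_left.1 (hd i j hne) (hx1 i) (hij ▸ hx1 j)
  have h0 : P - C m = 0 := by
    apply eq_zero_of_natDegree_lt_card_of_eval_eq_zero _ hinj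
    · intro i; simp [hx2]
    · have : (P - C m).natDegree ≤ k := by
        refine (natDegree_sub_le _ _).trans ?_
        simp [hP]
      simpa using Nat.lt_succ_of_le this
  have : P = C m := sub_eq_zero.1 h0
  have := h 0
  simp_all

open Polynomial in
lemma aux_up (A B : ℝ) (hAB : A < B) (M : ℝ) (d m : ℕ) : ∀ (f : ℝ → ℝ),
    ContDiffOn ℝ (⊤ : ℕ∞) f (Set.Ioo A B) →
    (∃ Q : ℝ[X], Q.natDegree ≤ d ∧ ∀ x ∈ Set.Ioo A B, |iteratedDeriv m f x - Q.eval x| ≤ M) →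
    ∃ P : ℝ[X], P.natDegree ≤ d + m ∧ ∀ x ∈ Set.Ioo A B, |f x - P.eval x| ≤ M * (B - A) ^ m := by
  induction m with
  | zero => intro f hf ⟨Q, h1, h2⟩; exact ⟨Q, h1, by simpa using h2⟩
  | succ m ih =>
    intro f hf ⟨Q, h1, h2⟩
    rw [iteratedDeriv_succ'] at h2
    obtain ⟨hd, hf'⟩ := (contDiffOn_infty_iff_deriv_of_isOpen isOpen_Ioo).1 hf
    obtain ⟨P, hP1, hP2⟩ := ih (deriv f) hf' ⟨Q, h1, h2⟩
    obtain ⟨P', hP'1, hP'2⟩ := aux_antideriv _ P hP1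
    set c := (A + B) / 2 with hc
    have hcm : c ∈ Set.Ioo A B := ⟨by linarith, by linarith⟩
    refine ⟨P' + C (f c - P'.eval c), ?_, ?_⟩
    · refine (natDegree_add_le _ _).trans ?_
      simp; omega
    · intro x hx
      have hder : ∀ y ∈ Set.Ioo A B, HasDerivWithinAt (fun y => f y - P'.eval y)
          (deriv f y - P.eval y) (Set.Ioo A B) y := by
        intro y hy
        have e1 : HasDerivAt f (deriv f y) y :=
          ((hd y hy).differentiableAt (isOpen_Ioo.mem_nhds hy)).hasDerivAt
        have e2 := P'.hasDerivAt y
        rw [hP'2] at e2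
        exact (e1.sub e2).hasDerivWithinAt
      have := (convex_Ioo A B).norm_image_sub_le_of_norm_hasDerivWithin_le hder
        (fun y hy => by simpa using hP2 y hy) hcm hx
      simp only [Real.norm_eq_abs] at this
      simp only [eval_add, eval_C]
      have h3 : |x - c| ≤ B - A := by
        rw [abs_le]; constructor <;> linarith [hx.1, hx.2, hcm.1, hcm.2]
      have hM : 0 ≤ M * (B - A) ^ m := (abs_nonneg _).trans (hP2 x hx)
      calc |f x - (P'.eval x + (f c - P'.eval c))| = |f x - P'.eval x - (f c - P'.eval c)| := by
            congr 1; ring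
        _ ≤ _ := this
        _ ≤ M * (B - A) ^ m * (B - A) := mul_le_mul_of_nonneg_left h3 hM
        _ = _ := by ring

lemma aux_holder (s : ℝ) (hs1 : 1 / 2 < s) (hs2 : s < 1) :
    ∃ K : ℝ, 0 < K ∧ ∀ (A B : ℝ) (_ : A < B) (u : ℝ → ℝ)
      (_ : ContDiffOn ℝ (⊤ : ℕ∞) u (Set.Icc A B)) (G : ℝ) (_ : 0 < G)
      (_ : gagliardo2 0 s (Set.Ioo A B) u ≤ ENNReal.ofReal G),
      ∀ x ∈ Set.Icc A B, ∀ y ∈ Set.Icc A B, |u x - u y| ^ 2 ≤ K * (B - A) ^ (2 * s - 1) * G := by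
  set γ : ℝ := s - 1 / 2 with hγ
  have hγ0 : 0 < γ := by linarith
  set θ : ℝ := (1 / 4 : ℝ) ^ (1 / γ) with hθ
  have hθ0 : 0 < θ := by positivity
  have hθγ : θ ^ γ = 1 / 4 := by
    rw [hθ, ← Real.rpow_mul (by norm_num)]
    rw [one_div_mul_cancel hγ0.ne', Real.rpow_one]
  have hθ2 : θ < 1 / 2 := by
    have h1 : θ ≤ (1 / 4 : ℝ) ^ (1 : ℝ) := by
      apply Real.rpow_le_rpow_of_exponent_ge (by norm_num) (by norm_num)
      rw [le_div_iff₀ hγ0]; linarith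
    rw [Real.rpow_one] at h1; linarith
  refine ⟨4 / θ ^ 2, by positivity, ?_⟩
  intro A B hAB u hu G hG hgag
  set S : Set ℝ := {K | 0 ≤ K ∧ ∀ x ∈ Set.Icc A B, ∀ y ∈ Set.Icc A B, x < y →
    |u x - u y| ≤ K * (y - x) ^ γ} with hS
  -- nonempty
  have hne : S.Nonempty := by
    have h1 : LocallyLipschitzOn (Set.Icc A B) u :=
      ContDiffOn.locallyLipschitzOn (convex_Icc A B) (hu.of_le (by exact_mod_cast le_top))
    obtain ⟨L, hL⟩ := h1.exists_lipschitzOnWith_of_compact isCompact_Icc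
    refine ⟨L * (B - A) ^ (1 - γ), by have : 0 < B - A := by linarith
                                      positivity, ?_⟩
    intro x hx y hy hxy
    have h2 := hL.dist_le_mul x hx y hy
    rw [Real.dist_eq, Real.dist_eq, abs_sub_comm x y, abs_of_pos (sub_pos.2 hxy)] at h2
    have h0 : 0 < y - x := sub_pos.2 hxy
    have h3 : y - x = (y - x) ^ (1 - γ) * (y - x) ^ γ := by
      rw [← Real.rpow_add h0]; simp
    have h4 : (y - x) ^ (1 - γ) ≤ (B - A) ^ (1 - γ) := by
      apply Real.rpow_le_rpow h0.le (by linarith [hx.1, hy.2]) (by linarith)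
    calc _ ≤ (L : ℝ) * (y - x) := h2
      _ = L * ((y - x) ^ (1 - γ) * (y - x) ^ γ) := by rw [← h3]
      _ ≤ L * ((B - A) ^ (1 - γ) * (y - x) ^ γ) := by gcongr
      _ = _ := by ring
  have hbdd : BddBelow S := ⟨0, fun K hK => hK.1⟩
  set K0 := sInf S with hK0
  have hK0mem : K0 ∈ S := by
    refine ⟨le_csInf hne fun K hK => hK.1, ?_⟩
    intro x hx y hy hxy
    have h0 : 0 < (y - x) ^ γ := Real.rpow_pos_of_pos (sub_pos.2 hxy) _
    rw [← div_le_iff₀ h0]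
    apply le_csInf hne
    intro K hK
    rw [div_le_iff₀ h0]
    exact hK.2 x hx y hy hxy
  -- improvement
  have himp : K0 / 2 + Real.sqrt G / θ ∈ S := by
    refine ⟨by have := hK0mem.1; positivity, ?_⟩
    intro x hx y hy hxy
    set h := y - x with hh
    have h0 : 0 < h := sub_pos.2 hxy
    have hhγ : 0 < h ^ γ := Real.rpow_pos_of_pos h0 _
    by_contra hcon
    push Not at hcon
    set D := |u x - u y| - K0 / 2 * h ^ γ with hD
    have hD1 : Real.sqrt G / θ * h ^ γ < D := by rw [hD]; linarith
    have hD0 : 0 < D := lt_of_le_of_lt (by positivity) hD1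
    have hθh : θ * h < h / 2 := by nlinarith
    have hθh0 : 0 < θ * h := by positivity
    have hpow : (θ * h) ^ γ = h ^ γ / 4 := by
      rw [Real.mul_rpow hθ0.le h0.le, hθγ]; ring
    have key : ∀ x' ∈ Set.Ioo x (x + θ * h), ∀ y' ∈ Set.Ioo (y - θ * h) y,
        D ^ 2 / h ^ (1 + 2 * s) ≤ |u x' - u y'| ^ 2 / |x' - y'| ^ (1 + 2 * s) := by
      intro x' hx' y' hy'
      have a1 := hK0mem.2 x hx x' ⟨by linarith [hx.1, hx'.1], by linarith [hx'.2, hy.2]⟩ hx'.1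
      have a2 := hK0mem.2 y' ⟨by linarith [hx.1, hy'.1], by linarith [hy'.2, hy.2]⟩ y hy hy'.2
      have a3 : (x' - x) ^ γ ≤ (θ * h) ^ γ :=
        Real.rpow_le_rpow (by linarith [hx'.1]) (by linarith [hx'.2]) hγ0.le
      have a4 : (y - y') ^ γ ≤ (θ * h) ^ γ :=
        Real.rpow_le_rpow (by linarith [hy'.2]) (by linarith [hy'.1]) hγ0.le
      rw [hpow] at a3 a4
      have b1 := mul_le_mul_of_nonneg_left a3 hK0mem.1
      have b2 := mul_le_mul_of_nonneg_left a4 hK0mem.1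
      have tri : |u x - u y| ≤ |u x - u x'| + |u x' - u y'| + |u y' - u y| := by
        have e : u x - u y = (u x - u x') + (u x' - u y') + (u y' - u y) := by ring
        rw [e]; exact abs_add_three _ _ _
      have hDle : D ≤ |u x' - u y'| := by rw [hD]; linarith
      have hlt : x' < y' := by linarith [hx'.2, hy'.1]
      rw [abs_sub_comm x' y', abs_of_pos (sub_pos.2 hlt)]
      apply div_le_div₀ (by positivity)
      · exact pow_le_pow_left₀ hD0.le hDle 2
      · exact Real.rpow_pos_of_pos (sub_pos.2 hlt) _
      · apply Real.rpow_le_rpow (by linarith) _ (by linarith)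
        linarith [hx'.1, hy'.2]
    have hint : ENNReal.ofReal (D ^ 2 / h ^ (1 + 2 * s) * ((θ * h) * (θ * h))) ≤ ENNReal.ofReal G := by
      refine le_trans ?_ hgag
      unfold gagliardo2
      calc ENNReal.ofReal (D ^ 2 / h ^ (1 + 2 * s) * ((θ * h) * (θ * h)))
          = ∫⁻ p in (Set.Ioo x (x + θ * h)) ×ˢ (Set.Ioo (y - θ * h) y),
              ENNReal.ofReal (D ^ 2 / h ^ (1 + 2 * s)) := by
            rw [setLIntegral_const, Measure.volume_eq_prod, Measure.prod_prod, Real.volume_Ioo,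
              Real.volume_Ioo, ← ENNReal.ofReal_mul (by linarith), ← ENNReal.ofReal_mul (by positivity)]
            congr 2; ring
        _ ≤ ∫⁻ p in (Set.Ioo x (x + θ * h)) ×ˢ (Set.Ioo (y - θ * h) y), ENNReal.ofReal
              (|iteratedDeriv 0 u p.1 - iteratedDeriv 0 u p.2| ^ 2 / |p.1 - p.2| ^ (1 + 2 * s)) := by
            apply setLIntegral_mono' (measurableSet_Ioo.prod measurableSet_Ioo)
            intro p hp
            apply ENNReal.ofReal_le_ofReal
            rw [iteratedDeriv_zero]
            exact key p.1 hp.1 p.2 hp.2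
        _ ≤ _ := by
            apply lintegral_mono_set
            apply Set.prod_mono
            · apply Set.Ioo_subset_Ioo hx.1; linarith [hy.2]
            · apply Set.Ioo_subset_Ioo _ hy.2; linarith [hx.1]
    rw [ENNReal.ofReal_le_ofReal_iff hG.le] at hint
    have e1 : h ^ (1 + 2 * s) = (h ^ γ) ^ 2 * h ^ 2 := by
      rw [← Real.rpow_natCast, ← Real.rpow_natCast, ← Real.rpow_mul h0.le, ← Real.rpow_add h0]
      congr 1; push_cast; rw [hγ]; ring
    have e2 : D ^ 2 / h ^ (1 + 2 * s) * ((θ * h) * (θ * h)) = (D * θ / h ^ γ) ^ 2 := by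
      rw [e1]; field_simp
    rw [e2] at hint
    have e3 : D * θ / h ^ γ ≤ Real.sqrt G := Real.le_sqrt_of_sq_le hint
    rw [div_le_iff₀ hhγ] at e3
    have e4 : D ≤ Real.sqrt G / θ * h ^ γ := by
      rw [div_mul_eq_mul_div, le_div_iff₀ hθ0]; exact e3
    linarith
  have hle : K0 ≤ K0 / 2 + Real.sqrt G / θ := csInf_le hbdd himp
  have hK02 : K0 ≤ 2 * Real.sqrt G / θ := by
    have : 2 * Real.sqrt G / θ = 2 * (Real.sqrt G / θ) := by ring
    linarith
  have fin : ∀ x ∈ Set.Icc A B, ∀ y ∈ Set.Icc A B, x < y →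
      |u x - u y| ^ 2 ≤ 4 / θ ^ 2 * (B - A) ^ (2 * s - 1) * G := by
    intro x hx y hy hxy
    have h1 := hK0mem.2 x hx y hy hxy
    have hBA : 0 < B - A := by linarith
    have h2 : (y - x) ^ γ ≤ (B - A) ^ γ :=
      Real.rpow_le_rpow (by linarith) (by linarith [hx.1, hy.2]) hγ0.le
    have h3 : |u x - u y| ≤ 2 * Real.sqrt G / θ * (B - A) ^ γ := by
      refine h1.trans (mul_le_mul hK02 h2 ?_ (by positivity))
      exact Real.rpow_nonneg (by linarith) _
    have h4 := pow_le_pow_left₀ (abs_nonneg _) h3 2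
    refine h4.trans (le_of_eq ?_)
    have : (B - A) ^ (2 * s - 1) = ((B - A) ^ γ) ^ 2 := by
      rw [← Real.rpow_natCast, ← Real.rpow_mul hBA.le]; congr 1; push_cast; rw [hγ]; ring
    rw [this, mul_pow, div_pow, mul_pow, Real.sq_sqrt hG.le]; ring
  intro x hx y hy
  rcases lt_trichotomy x y with h | h | h
  · exact fin x hx y hy h
  · subst h
    have hBA : 0 < B - A := by linarith
    simp; positivity
  · rw [abs_sub_comm]; exact fin y hy x hx h

open Polynomial in
lemma aux_succ (m : ℕ) (s : ℝ) (hs0 : 0 < s) (A B : ℝ) (hAB : A < B) (u : ℝ → ℝ)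
    (hu : ContDiffOn ℝ (⊤ : ℕ∞) u (Set.Ioo A B)) (G : ℝ) (hG : 0 < G)
    (hgag : gagliardo2 (m + 1) s (Set.Ioo A B) u ≤ ENNReal.ofReal G) :
    ∃ P : ℝ[X], P.natDegree ≤ m + 1 ∧
      ∀ x ∈ Set.Ioo A B, |u x - P.eval x| ^ 2 ≤ (B - A) ^ (2 * (((m + 1 : ℕ) : ℝ) + s) - 1) * G := by
  set g := iteratedDeriv (m + 1) u with hg
  set f := iteratedDeriv m u with hf
  have hgf : g = deriv f := by rw [hg, iteratedDeriv_succ]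
  have hgmeas : Measurable g := by rw [hgf]; exact measurable_deriv f
  set l := B - A with hl
  have hl0 : 0 < l := by rw [hl]; linarith
  -- smoothness of f
  have hfs : ∀ (j : ℕ), ContDiffOn ℝ (⊤ : ℕ∞) (iteratedDeriv j u) (Set.Ioo A B) := by
    intro j
    induction j with
    | zero => simpa using hu
    | succ j ih =>
      rw [iteratedDeriv_succ]
      exact ((contDiffOn_infty_iff_deriv_of_isOpen isOpen_Ioo).1 ih).2
  have hgc : ContinuousOn g (Set.Ioo A B) := (hfs (m + 1)).continuousOn
  have hfd : ∀ x ∈ Set.Ioo A B, HasDerivAt f (g x) x := by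
    intro x hx
    rw [hgf]
    exact (((contDiffOn_infty_iff_deriv_of_isOpen isOpen_Ioo).1 (hfs m)).1.differentiableAt
      (isOpen_Ioo.mem_nhds hx)).hasDerivAt
  set F : ℝ → ℝ → ℝ≥0∞ := fun y x => ENNReal.ofReal (|g y - g x| ^ 2) with hF
  have hFm : Measurable (fun p : ℝ × ℝ => F p.1 p.2) := by
    rw [hF]
    have h1 : Measurable fun p : ℝ × ℝ => g p.1 := hgmeas.comp measurable_fst
    have h2 : Measurable fun p : ℝ × ℝ => g p.2 := hgmeas.comp measurable_snd
    have h3 : Measurable fun p : ℝ × ℝ => |g p.1 - g p.2| := (h1.sub h2).abs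
    exact (h3.pow_const 2).ennreal_ofReal
  have htot : ∫⁻ y in Set.Ioo A B, ∫⁻ x in Set.Ioo A B, F y x
      ≤ ENNReal.ofReal (l ^ (1 + 2 * s) * G) := by
    have e : ∫⁻ y in Set.Ioo A B, ∫⁻ x in Set.Ioo A B, F y x
        = ∫⁻ p in (Set.Ioo A B) ×ˢ (Set.Ioo A B), F p.1 p.2 := by
      rw [Measure.volume_eq_prod, ← Measure.prod_restrict,
        lintegral_prod (μ := volume.restrict (Set.Ioo A B)) (ν := volume.restrict (Set.Ioo A B))
          (fun p : ℝ × ℝ => F p.1 p.2) hFm.aemeasurable]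
    rw [e, ENNReal.ofReal_mul (by positivity)]
    refine le_trans ?_ (mul_le_mul_right hgag _)
    unfold gagliardo2
    rw [← lintegral_const_mul' _ _ ENNReal.ofReal_ne_top]
    apply setLIntegral_mono' (measurableSet_Ioo.prod measurableSet_Ioo)
    rintro ⟨y, x⟩ ⟨hy, hx⟩
    simp only at hx hy
    simp only [hF]
    rw [← ENNReal.ofReal_mul (by positivity)]
    apply ENNReal.ofReal_le_ofReal
    by_cases hyx : y = x
    · subst hyx; simp
    · have h0 : 0 < |y - x| := abs_pos.2 (sub_ne_zero.2 hyx)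
      have h1 : |y - x| ≤ l := by
        rw [abs_le]; constructor <;> linarith [hy.1, hy.2, hx.1, hx.2]
      have h2 : |y - x| ^ (1 + 2 * s) ≤ l ^ (1 + 2 * s) := Real.rpow_le_rpow h0.le h1 (by linarith)
      have h3 : 0 < |y - x| ^ (1 + 2 * s) := Real.rpow_pos_of_pos h0 _
      rw [← mul_div_assoc, le_div_iff₀ h3, mul_comm]
      exact mul_le_mul_of_nonneg_right h2 (by positivity)
  have hvol : volume (Set.Ioo A B) = ENNReal.ofReal l := by rw [Real.volume_Ioo]
  obtain ⟨y, hy, hyle⟩ := exists_le_setLAverage (μ := volume) (s := Set.Ioo A B)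
    (f := fun y => ∫⁻ x in Set.Ioo A B, F y x)
    (by rw [hvol]; simpa using hl0) (by rw [hvol]; exact ENNReal.ofReal_ne_top)
    (hFm.lintegral_prod_right' (ν := volume.restrict (Set.Ioo A B))).aemeasurable
  have hyle2 : ∫⁻ x in Set.Ioo A B, F y x ≤ ENNReal.ofReal (l ^ (2 * s) * G) := by
    refine hyle.trans ?_
    rw [setLAverage_eq, hvol]
    refine (ENNReal.div_le_div_right htot _).trans ?_
    rw [← ENNReal.ofReal_div_of_pos hl0]
    apply ENNReal.ofReal_le_ofReal
    rw [add_comm, Real.rpow_add hl0, Real.rpow_one]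
    apply le_of_eq; field_simp
  set Q := l ^ (2 * s) * G with hQ
  have hQ0 : 0 < Q := by positivity
  set M := Real.sqrt (l * Q) with hM
  have hM0 : 0 < M := Real.sqrt_pos.2 (by positivity)
  have hM2 : M ^ 2 = l * Q := Real.sq_sqrt (by positivity)
  -- increments
  have hinc : ∀ x ∈ Set.Ioo A B, ∀ z ∈ Set.Ioo A B, x ≤ z →
      |(f z - g y * z) - (f x - g y * x)| ≤ M := by
    intro x hx z hz hxz
    have hsub : Set.Icc x z ⊆ Set.Ioo A B := fun t ht => ⟨by linarith [hx.1, ht.1], by linarith [ht.2, hz.2]⟩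
    have hcont : ContinuousOn (fun t => g t - g y) (Set.Icc x z) :=
      (hgc.mono hsub).sub continuousOn_const
    have hftc : ∫ t in x..z, (g t - g y) = (f z - g y * z) - (f x - g y * x) := by
      apply intervalIntegral.integral_eq_sub_of_hasDerivAt (f := fun t => f t - g y * t)
      · intro t ht
        rw [Set.uIcc_of_le hxz] at ht
        have := (hfd t (hsub ht)).sub ((hasDerivAt_id t).const_mul (g y))
        rw [mul_one] at this
        exact this
      · apply ContinuousOn.intervalIntegrable
        rw [Set.uIcc_of_le hxz]; exact hcont
    rw [← hftc]
    set τ := M / l with hτ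
    have hτ0 : 0 < τ := by positivity
    have hsqint : IntervalIntegrable (fun t => (g t - g y) ^ 2) volume x z := by
      apply ContinuousOn.intervalIntegrable
      rw [Set.uIcc_of_le hxz]; exact hcont.pow 2
    have hsq : ∫ t in x..z, (g t - g y) ^ 2 ≤ Q := by
      rw [intervalIntegral.integral_of_le hxz,
        integral_eq_lintegral_of_nonneg_ae (Eventually.of_forall fun t => sq_nonneg _)
          ((hgmeas.sub_const _).pow_const 2).aestronglyMeasurable]
      apply ENNReal.toReal_le_of_le_ofReal hQ0.le
      refine le_trans ?_ hyle2
      have : Set.Ioc x z ⊆ Set.Ioo A B := fun t ht => hsub ⟨ht.1.le, ht.2⟩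
      refine (lintegral_mono_set this).trans (le_of_eq ?_)
      congr 1; funext t
      simp only [hF]
      rw [sq_abs]; congr 1; ring
    have habs : |∫ t in x..z, (g t - g y)| ≤ ∫ t in x..z, ((g t - g y) ^ 2 / τ + τ) / 2 := by
      refine (intervalIntegral.abs_integral_le_integral_abs hxz).trans ?_
      apply intervalIntegral.integral_mono_on hxz
      · apply ContinuousOn.intervalIntegrable
        rw [Set.uIcc_of_le hxz]; exact hcont.abs
      · exact ((hsqint.div_const _).add intervalIntegrable_const).div_const _
      · intro t ht
        rw [le_div_iff₀ (by norm_num), div_add' _ _ _ hτ0.ne', le_div_iff₀ hτ0, ← sq_abs]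
        nlinarith [sq_nonneg (|g t - g y| - τ)]
    refine habs.trans ?_
    rw [intervalIntegral.integral_div, intervalIntegral.integral_add (hsqint.div_const _) intervalIntegrable_const,
      intervalIntegral.integral_div, intervalIntegral.integral_const, smul_eq_mul]
    have h1 : (∫ t in x..z, (g t - g y) ^ 2) / τ ≤ Q / τ := by gcongr
    have h2 : (z - x) * τ ≤ l * τ := by
      apply mul_le_mul_of_nonneg_right _ hτ0.le
      linarith [hx.1, hz.2]
    have h3 : l * τ = M := by rw [hτ]; field_simp
    have h4 : Q / τ = M := by
      rw [hτ]; field_simp; linarith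
    linarith
  set c := (A + B) / 2 with hc
  have hcm : c ∈ Set.Ioo A B := ⟨by linarith, by linarith⟩
  obtain ⟨P, hP1, hP2⟩ := aux_up A B hAB M 1 m u hu
    ⟨C (g y) * X + C (f c - g y * c), natDegree_linear_le, by
      intro x hx
      simp only [eval_add, eval_mul, eval_C, eval_X]
      rcases le_total c x with h | h
      · have := hinc c hcm x hx h
        rw [← hf]
        convert this using 2; ring
      · have := hinc x hx c hcm h
        rw [← hf, abs_sub_comm]
        convert this using 2; ring⟩
  refine ⟨P, by omega, ?_⟩
  intro x hx
  have h1 := pow_le_pow_left₀ (abs_nonneg _) (hP2 x hx) 2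
  refine h1.trans (le_of_eq ?_)
  rw [mul_pow, hM2, hQ, ← hl]
  have : l ^ (2 * (((m + 1 : ℕ) : ℝ) + s) - 1) = l ^ (2 * s) * l * (l ^ m) ^ 2 := by
    rw [← pow_mul, ← Real.rpow_natCast l (m * 2)]
    nth_rewrite 3 [← Real.rpow_one l]
    rw [← Real.rpow_add hl0, ← Real.rpow_add hl0]
    congr 1; push_cast; ring
  rw [this]; ring

open Polynomial in
lemma aux_core (k : ℕ) (s : ℝ) (hs : s ∈ Set.Ioo (0:ℝ) 1) (hks : 1 / 2 < (k : ℝ) + s) :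
    ∃ K : ℝ, 0 < K ∧ ∀ (A B : ℝ) (_ : A < B) (u : ℝ → ℝ)
      (_ : ContDiffOn ℝ (⊤ : ℕ∞) u (Set.Icc A B)) (G : ℝ) (_ : 0 < G)
      (_ : gagliardo2 k s (Set.Ioo A B) u ≤ ENNReal.ofReal G),
      ∃ P : ℝ[X], P.natDegree ≤ k ∧ ∀ x ∈ Set.Icc A B,
        |u x - P.eval x| ^ 2 ≤ K * (B - A) ^ (2 * ((k : ℝ) + s) - 1) * G := by
  rcases k with _ | m
  · simp only [Nat.cast_zero, zero_add] at hks ⊢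
    obtain ⟨K, hK, h⟩ := aux_holder s hks hs.2
    refine ⟨K, hK, ?_⟩
    intro A B hAB u hu G hG hgag
    refine ⟨C (u A), by simp, ?_⟩
    intro x hx
    simp only [eval_C]
    exact h A B hAB u hu G hG hgag x hx A ⟨le_rfl, hAB.le⟩
  · refine ⟨1, one_pos, ?_⟩
    intro A B hAB u hu G hG hgag
    obtain ⟨P, hP1, hP2⟩ := aux_succ m s hs.1 A B hAB u (hu.mono Set.Ioo_subset_Icc_self) G hG hgag
    refine ⟨P, hP1, ?_⟩
    rw [one_mul, ← closure_Ioo hAB.ne]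
    have hc : ContinuousOn (fun x => |u x - P.eval x| ^ 2) (closure (Set.Ioo A B)) := by
      rw [closure_Ioo hAB.ne]
      exact ((hu.continuousOn.sub P.continuous.continuousOn).abs).pow 2
    intro x hx
    exact le_on_closure hP2 hc continuousOn_const hx

/-- Localized energy. -/
noncomputable def locE (W : ℝ → ℝ) (k : ℕ) (s : ℝ) (a : ℝ × ℝ → ℝ) (ε : ℝ) (u : ℝ → ℝ)
    (I : Set ℝ) : ℝ≥0∞ :=
  ENNReal.ofReal (1 / ε) * (∫⁻ x in I, ENNReal.ofReal (W (u x))) +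
    ENNReal.ofReal (ε ^ (2 * ((k : ℝ) + s) - 1)) *
      ∫⁻ p in I ×ˢ I, ENNReal.ofReal
        (a p * |iteratedDeriv k u p.1 - iteratedDeriv k u p.2| ^ 2 / |p.1 - p.2| ^ (1 + 2 * s))

lemma locE_mono (W : ℝ → ℝ) (k : ℕ) (s : ℝ) (a : ℝ × ℝ → ℝ) (ε : ℝ) (u : ℝ → ℝ)
    {I J : Set ℝ} (h : I ⊆ J) : locE W k s a ε u I ≤ locE W k s a ε u J := by
  unfold locE
  exact add_le_add (mul_le_mul_right (lintegral_mono_set h) _)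
    (mul_le_mul_right (lintegral_mono_set (Set.prod_mono h h)) _)

open Polynomial in
lemma aux_approx (k : ℕ) (s : ℝ) (hs : s ∈ Set.Ioo (0:ℝ) 1) (hks : 1 / 2 < (k : ℝ) + s)
    (W : ℝ → ℝ) (αa : ℝ) (hαa : 0 < αa) :
    ∃ K : ℝ, 0 < K ∧ ∀ (c : ℝ) (_ : 0 < c) (ε : ℝ) (_ : 0 < ε) (a : ℝ × ℝ → ℝ)
      (_ : ∀ᵐ p : ℝ × ℝ ∂volume, αa ≤ a p)
      (A B : ℝ) (_ : A < B) (_ : B - A ≤ ε) (u : ℝ → ℝ)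
      (_ : ContDiffOn ℝ (⊤ : ℕ∞) u (Set.Icc A B))
      (_ : locE W k s a ε u (Set.Ioo A B) ≤ ENNReal.ofReal c),
      ∃ P : ℝ[X], P.natDegree ≤ k ∧ ∀ x ∈ Set.Icc A B, |u x - P.eval x| ^ 2 ≤ K * c := by
  obtain ⟨K, hK, hcore⟩ := aux_core k s hs hks
  refine ⟨K / αa, by positivity, ?_⟩
  intro c hc ε hε a ha A B hAB hBA u hu hE
  set β := 2 * ((k : ℝ) + s) - 1 with hβ
  have hβ0 : 0 < β := by linarith
  have hεβ : 0 < ε ^ β := Real.rpow_pos_of_pos hε _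
  have h1 : ENNReal.ofReal αa * gagliardo2 k s (Set.Ioo A B) u ≤
      ∫⁻ p in (Set.Ioo A B) ×ˢ (Set.Ioo A B), ENNReal.ofReal
        (a p * |iteratedDeriv k u p.1 - iteratedDeriv k u p.2| ^ 2 / |p.1 - p.2| ^ (1 + 2 * s)) := by
    unfold gagliardo2
    rw [← lintegral_const_mul' _ _ ENNReal.ofReal_ne_top]
    apply lintegral_mono_ae
    filter_upwards [ae_restrict_of_ae ha] with p hp
    rw [← ENNReal.ofReal_mul hαa.le]
    apply ENNReal.ofReal_le_ofReal
    rw [← mul_div_assoc]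
    gcongr
  have h2 : ENNReal.ofReal (ε ^ β * αa) * gagliardo2 k s (Set.Ioo A B) u ≤ ENNReal.ofReal c := by
    refine le_trans ?_ hE
    rw [ENNReal.ofReal_mul hεβ.le, mul_assoc]
    refine (mul_le_mul_right h1 _).trans ?_
    unfold locE
    exact le_add_self
  have hpos : 0 < ε ^ β * αa := by positivity
  have h3 : gagliardo2 k s (Set.Ioo A B) u ≤ ENNReal.ofReal (c / (ε ^ β * αa)) := by
    rw [ENNReal.ofReal_div_of_pos hpos, ENNReal.le_div_iff_mul_le (Or.inl (by simpa using hpos))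
      (Or.inl ENNReal.ofReal_ne_top), mul_comm]
    exact h2
  obtain ⟨P, hP1, hP2⟩ := hcore A B hAB u hu _ (by positivity) h3
  refine ⟨P, hP1, fun x hx => (hP2 x hx).trans ?_⟩
  have h4 : (B - A) ^ β ≤ ε ^ β := Real.rpow_le_rpow (by linarith) hBA hβ0.le
  calc K * (B - A) ^ β * (c / (ε ^ β * αa)) ≤ K * ε ^ β * (c / (ε ^ β * αa)) := by gcongr
    _ = _ := by field_simp

lemma aux_W (W : ℝ → ℝ) (αW βW : ℝ) (hW : IsDoubleWell W αW βW) (δ : ℝ) (hδ : 0 < δ) :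
    ∃ w : ℝ, 0 < w ∧ ∀ z, δ < |(|z| - 1)| → w ≤ W z := by
  obtain ⟨c, hc, h⟩ := hW.far_pos
  have := hW.alpha_pos
  refine ⟨min (αW * δ ^ 2) c, lt_min (by positivity) hc, ?_⟩
  intro z hz
  rcases le_total |z| 2 with h2 | h2
  · refine (min_le_left _ _).trans (le_trans ?_ (hW.lower z h2))
    rw [← sq_abs (1 - |z|), abs_sub_comm]
    gcongr
  · exact (min_le_right _ _).trans (h z h2)

open Polynomial in
lemma aux_local (k : ℕ) (s : ℝ) (hs : s ∈ Set.Ioo (0:ℝ) 1) (hks : 1 / 2 < (k : ℝ) + s)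
    (W : ℝ → ℝ) (αW βW : ℝ) (hW : IsDoubleWell W αW βW) (αa : ℝ) (hαa : 0 < αa)
    (l1 l2 : ℝ) (hl : l1 < l2) (hl1 : l1 ≠ 1) (hl1' : l1 ≠ -1) :
    ∃ c : ℝ, 0 < c ∧ ∀ (ε : ℝ) (_ : 0 < ε) (a : ℝ × ℝ → ℝ)
      (_ : ∀ᵐ p : ℝ × ℝ ∂volume, αa ≤ a p)
      (A B : ℝ) (_ : A < B) (u : ℝ → ℝ)
      (_ : ContDiffOn ℝ (⊤ : ℕ∞) u (Set.Icc A B)) (p q : Fin (k + 1) → ℝ)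
      (_ : ∀ i, A ≤ p i ∧ p i < q i ∧ q i ≤ B)
      (_ : ∀ i j, i ≠ j → Disjoint (Set.Ioo (p i) (q i)) (Set.Ioo (p j) (q j)))
      (_ : ∀ i, ({u (p i), u (q i)} : Set ℝ) = {l1, l2}),
      ENNReal.ofReal c ≤ locE W k s a ε u (Set.Ioo A B) := by
  obtain ⟨K, hK, happ⟩ := aux_approx k s hs hks W αa hαa
  set R : ℝ := 4 * k + 4 with hR
  have hR1 : 1 ≤ R := by
    have : (0:ℝ) ≤ k := Nat.cast_nonneg k
    linarith
  have hR0 : 0 < R := by linarith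
  set C0 : ℝ := (k + 1) * R ^ k with hC0
  have hC0p : 0 < C0 := by positivity
  have d1 : 0 < |l1 - 1| := abs_pos.2 (sub_ne_zero.2 hl1)
  have d2 : 0 < |l1 + 1| := abs_pos.2 (by intro h; apply hl1'; linarith)
  set d := min |l1 - 1| |l1 + 1| with hd
  have hd0 : 0 < d := lt_min d1 d2
  set δ := min (d / (2 * (2 * C0 + 1))) ((l2 - l1) / 4) with hδ
  have hδ0 : 0 < δ := lt_min (by positivity) (by linarith)
  have hδ1 : (2 * C0 + 1) * δ < d := by
    have h : δ ≤ d / (2 * (2 * C0 + 1)) := min_le_left _ _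
    rw [le_div_iff₀ (by positivity)] at h
    nlinarith
  have hδ2 : δ ≤ (l2 - l1) / 4 := min_le_right _ _
  obtain ⟨w, hw0, hw⟩ := aux_W W αW βW hW δ hδ0
  set c := min (δ ^ 2 / K) (w / (2 * R)) with hc
  have hc0 : 0 < c := lt_min (by positivity) (by positivity)
  have hKc : K * c ≤ δ ^ 2 := by
    have h : c ≤ δ ^ 2 / K := min_le_left _ _
    rw [le_div_iff₀ hK] at h; linarith
  have hcw : c < w / R := by
    refine lt_of_le_of_lt (min_le_right _ _) ?_
    apply div_lt_div_of_pos_left hw0 hR0; linarith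
  refine ⟨c, hc0, ?_⟩
  intro ε hε a ha A B hAB u hu p q hpq hdis htr
  have hcase : ∀ i, (u (p i) = l1 ∧ u (q i) = l2) ∨ (u (p i) = l2 ∧ u (q i) = l1) := by
    intro i
    exact Set.pair_eq_pair_iff.1 (htr i)
  by_contra hcon
  push Not at hcon
  rcases le_total (B - A) ε with hBA | hBA
  · -- short interval
    obtain ⟨P, hP1, hP2⟩ := happ c hc0 ε hε a ha A B hAB hBA u hu hcon.le
    have hP3 : ∀ x ∈ Set.Icc A B, |u x - P.eval x| ≤ δ := fun x hx =>
      (pow_le_pow_iff_left₀ (abs_nonneg _) hδ0.le two_ne_zero).1 ((hP2 x hx).trans hKc)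
    apply aux_poly_trans k P hP1 ((l1 + l2) / 2) p q (fun i => (hpq i).2.1) hdis
    intro i
    obtain ⟨i1, i2, i3⟩ := hpq i
    have e1 := abs_le.1 (hP3 (p i) ⟨i1, by linarith⟩)
    have e2 := abs_le.1 (hP3 (q i) ⟨by linarith, i3⟩)
    rcases hcase i with ⟨h1, h2⟩ | ⟨h1, h2⟩
    · left; rw [h1] at e1; rw [h2] at e2; constructor <;> linarith
    · right; rw [h1] at e1; rw [h2] at e2; constructor <;> linarith
  · -- long interval
    have hx0 : ∃ x0 ∈ Set.Icc A B, u x0 = l1 := by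
      obtain ⟨i1, i2, i3⟩ := hpq 0
      rcases hcase 0 with ⟨h1, h2⟩ | ⟨h1, h2⟩
      · exact ⟨p 0, ⟨i1, by linarith⟩, h1⟩
      · exact ⟨q 0, ⟨by linarith, i3⟩, h2⟩
    obtain ⟨x0, hx0, hux0⟩ := hx0
    obtain ⟨A', hA1, hA2, hA3⟩ : ∃ A', A ≤ A' ∧ A' + ε ≤ B ∧ x0 ∈ Set.Icc A' (A' + ε) := by
      rcases le_total (x0 + ε) B with h | h
      · exact ⟨x0, hx0.1, h, le_rfl, by linarith⟩
      · exact ⟨B - ε, by linarith, by linarith, by linarith, by linarith [hx0.2]⟩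
    have hsub : Set.Icc A' (A' + ε) ⊆ Set.Icc A B := Set.Icc_subset_Icc hA1 hA2
    have hE : locE W k s a ε u (Set.Ioo A' (A' + ε)) < ENNReal.ofReal c :=
      lt_of_le_of_lt (locE_mono W k s a ε u (Set.Ioo_subset_Ioo hA1 hA2)) hcon
    obtain ⟨P, hP1, hP2⟩ := happ c hc0 ε hε a ha A' (A' + ε) (by linarith) (by linarith) u
      (hu.mono hsub) hE.le
    have hP3 : ∀ x ∈ Set.Icc A' (A' + ε), |u x - P.eval x| ≤ δ := fun x hx =>
      (pow_le_pow_iff_left₀ (abs_nonneg _) hδ0.le two_ne_zero).1 ((hP2 x hx).trans hKc)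
    set η := ε / R with hη
    have hη0 : 0 < η := by positivity
    have hηR : η * R = ε := by rw [hη]; field_simp
    have hcell : ∀ i : Fin (2 * k + 2), Set.Ioo (A' + 2 * i * η) (A' + (2 * i + 1) * η) ⊆
        Set.Ioo A' (A' + ε) := by
      intro i
      have hi : ((i : ℕ) : ℝ) + 1 ≤ 2 * k + 2 := by exact_mod_cast i.2
      have hi0 : (0:ℝ) ≤ ((i : ℕ) : ℝ) := Nat.cast_nonneg _
      apply Set.Ioo_subset_Ioo
      · have : 0 ≤ 2 * ((i : ℕ) : ℝ) * η := by positivity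
        linarith
      · have : (2 * ((i : ℕ) : ℝ) + 1) * η ≤ R * η := by
          apply mul_le_mul_of_nonneg_right _ hη0.le
          rw [hR]; linarith
        linarith
    have hpts : ∀ i : Fin (2 * k + 2), ∃ x ∈ Set.Ioo (A' + 2 * i * η) (A' + (2 * i + 1) * η),
        |(|u x| - 1)| ≤ δ := by
      intro i
      by_contra hno
      push Not at hno
      apply absurd hE
      rw [not_lt]
      calc ENNReal.ofReal c ≤ ENNReal.ofReal (1 / ε * (w * η)) := by
            apply ENNReal.ofReal_le_ofReal
            refine hcw.le.trans (le_of_eq ?_)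
            rw [hη]; field_simp
        _ = ENNReal.ofReal (1 / ε) * ∫⁻ x in Set.Ioo (A' + 2 * i * η) (A' + (2 * i + 1) * η),
              ENNReal.ofReal w := by
            rw [setLIntegral_const, Real.volume_Ioo, ← ENNReal.ofReal_mul hw0.le,
              ← ENNReal.ofReal_mul (by positivity)]
            congr 3; ring
        _ ≤ ENNReal.ofReal (1 / ε) * ∫⁻ x in Set.Ioo (A' + 2 * i * η) (A' + (2 * i + 1) * η),
              ENNReal.ofReal (W (u x)) := by
            apply mul_le_mul_right
            apply setLIntegral_mono' measurableSet_Ioo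
            intro x hx
            exact ENNReal.ofReal_le_ofReal (hw _ (hno x hx))
        _ ≤ ENNReal.ofReal (1 / ε) * ∫⁻ x in Set.Ioo A' (A' + ε), ENNReal.ofReal (W (u x)) := by
            apply mul_le_mul_right
            exact lintegral_mono_set (hcell i)
        _ ≤ _ := by unfold locE; exact le_self_add
    choose x hx1 hx2 using hpts
    have hsgn : ∀ i, ∃ b : Bool, |u (x i) - (if b then 1 else -1)| ≤ δ := by
      intro i
      have := hx2 i
      rcases le_total 0 (u (x i)) with h | h
      · exact ⟨true, by rw [abs_of_nonneg h] at this; simpa using this⟩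
      · refine ⟨false, ?_⟩
        rw [abs_of_nonpos h, abs_sub_comm] at this
        simp only [Bool.false_eq_true, if_false]
        convert this using 2; ring
    choose b hb using hsgn
    obtain ⟨b0, hb0⟩ := Fintype.exists_le_card_fiber_of_mul_le_card b (n := k + 1)
      (by simp; omega)
    obtain ⟨S, hS1, hS2⟩ := Finset.exists_subset_card_eq hb0
    have hSb : ∀ i ∈ S, b i = b0 := fun i hi => (Finset.mem_filter.1 (hS1 hi)).2
    set ω : ℝ := if b0 then 1 else -1 with hω
    have hxm : ∀ i, x i ∈ Set.Icc A' (A' + ε) := fun i =>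
      Set.Ioo_subset_Icc_self (hcell i (hx1 i))
    have hsep : ∀ i j : Fin (2 * k + 2), i < j → η ≤ x j - x i := by
      intro i j hij
      have h1 := (hx1 i).2
      have h2 := (hx1 j).1
      have h3 : ((i : ℕ) : ℝ) + 1 ≤ ((j : ℕ) : ℝ) := by exact_mod_cast hij
      have h4 : (2 * ((i : ℕ) : ℝ) + 2) * η ≤ 2 * ((j : ℕ) : ℝ) * η :=
        mul_le_mul_of_nonneg_right (by linarith) hη0.le
      linarith
    have hlag := aux_lagrange k P hP1 A' ε R (2 * δ) hε hR1 (Fin (2 * k + 2)) S hS2 x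
      (fun i _ => hxm i)
      (by
        intro i _ j _ hij
        have : η ≤ |x i - x j| := by
          rcases lt_or_gt_of_ne hij with h | h
          · rw [abs_sub_comm]; exact (hsep i j h).trans (le_abs_self _)
          · exact (hsep j i h).trans (le_abs_self _)
        nlinarith)
      ω
      (by
        intro i hi
        have h1 := hb i
        rw [hSb i hi, ← hω] at h1
        have h2 := hP3 (x i) (hxm i)
        rw [abs_le] at h1 h2 ⊢
        constructor <;> linarith [h1.1, h1.2, h2.1, h2.2])
      x0 hA3
    have h2 := hP3 x0 hA3
    rw [hux0] at h2
    have h3 : |l1 - ω| ≤ (2 * C0 + 1) * δ := by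
      have e : l1 - ω = (l1 - P.eval x0) + (P.eval x0 - ω) := by ring
      rw [e]
      refine (abs_add_le _ _).trans ?_
      rw [← hC0] at hlag
      linarith
    have h4 : d ≤ |l1 - ω| := by
      rw [hω]
      cases b0
      · simp [hd]
      · simp [hd]
    linarith

lemma locE_sum (W : ℝ → ℝ) (k : ℕ) (s : ℝ) (a : ℝ × ℝ → ℝ) (ε : ℝ) (u : ℝ → ℝ) (m : ℕ)
    (I : Fin m → Set ℝ) (hm : ∀ j, MeasurableSet (I j)) (J : Set ℝ) (hIJ : ∀ j, I j ⊆ J)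
    (hd : ∀ i j, i ≠ j → Disjoint (I i) (I j)) :
    ∑ j, locE W k s a ε u (I j) ≤ locE W k s a ε u J := by
  unfold locE
  rw [Finset.sum_add_distrib, ← Finset.mul_sum, ← Finset.mul_sum]
  refine add_le_add (mul_le_mul_right ?_ _) (mul_le_mul_right ?_ _)
  · rw [← lintegral_biUnion_finset (s := Finset.univ) (t := I)
      (fun i _ j _ hij => hd i j hij) (fun j _ => hm j)]
    apply lintegral_mono_set
    simpa using hIJ
  · rw [← lintegral_biUnion_finset (s := Finset.univ) (t := fun j => I j ×ˢ I j)
      (fun i _ j _ hij => Set.disjoint_prod.2 (Or.inl (hd i j hij)))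
      (fun j _ => (hm j).prod (hm j))]
    apply lintegral_mono_set
    exact Set.iUnion₂_subset fun j _ => Set.prod_mono (hIJ j) (hIJ j)

/-- **bound on the number of transition intervals.** If the smooth family
`(u_ε)` is bounded in energy, then for every `λ₁ < λ₂` with `[λ₁,λ₂] ∩ {±1} = ∅` the
number of pairwise disjoint transition intervals of `u_ε` between `λ₁` and `λ₂`
contained in `(0,1)` is bounded independently of `ε`. -/
theorem statement7
    (k : ℕ) (s : ℝ) (hs : s ∈ Set.Ioo (0:ℝ) 1) (hks : 1 / 2 < (k : ℝ) + s)
    (W : ℝ → ℝ) (αW βW : ℝ) (hW : IsDoubleWell W αW βW)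
    (a : ℝ → ℝ × ℝ → ℝ) (αa βa : ℝ)
    (ha : ∀ ε ∈ Set.Ioi (0:ℝ), IsHomKernel (a ε) αa βa)
    (u : ℝ → ℝ → ℝ)
    (husmooth : ∀ ε ∈ Set.Ioi (0:ℝ), ContDiffOn ℝ (⊤ : ℕ∞) (u ε) (Set.Icc 0 1))
    (hbd : ∃ C : ℝ≥0∞, C < ⊤ ∧ ∀ ε ∈ Set.Ioi (0:ℝ), Fen W k s (a ε) ε (u ε) ≤ C)
    (l1 l2 : ℝ) (hl : l1 < l2) (hlpm : Set.Icc l1 l2 ∩ ({-1, 1} : Set ℝ) = ∅) :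
    ∃ N : ℕ, ∀ ε ∈ Set.Ioi (0:ℝ), ∀ n : ℕ, ∀ p q : Fin n → ℝ,
      (∀ i, 0 ≤ p i ∧ p i < q i ∧ q i ≤ 1) →
      (∀ i j, i ≠ j → Disjoint (Set.Ioo (p i) (q i)) (Set.Ioo (p j) (q j))) →
      (∀ i, ({u ε (p i), u ε (q i)} : Set ℝ) = {l1, l2}) →
      n ≤ N := by
  have hα : 0 < αa := (ha 1 (by norm_num)).alpha_pos
  have hl1 : l1 ≠ 1 := by
    rintro rfl
    have : (1:ℝ) ∈ Set.Icc 1 l2 ∩ ({-1, 1} : Set ℝ) := ⟨⟨le_rfl, hl.le⟩, by simp⟩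
    rw [hlpm] at this; exact this
  have hl1' : l1 ≠ -1 := by
    rintro rfl
    have : (-1:ℝ) ∈ Set.Icc (-1) l2 ∩ ({-1, 1} : Set ℝ) := ⟨⟨le_rfl, hl.le⟩, by simp⟩
    rw [hlpm] at this; exact this
  obtain ⟨c, hc, hloc⟩ := aux_local k s hs hks W αW βW hW αa hα l1 l2 hl hl1 hl1'
  obtain ⟨C, hC, hE⟩ := hbd
  obtain ⟨M, hM⟩ := exists_nat_gt (C.toReal / c)
  refine ⟨(k + 1) * (M + 1), ?_⟩
  intro ε hε n p q hpq hdis htr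
  set σ := Tuple.sort p with hσ
  have hmono : Monotone (p ∘ σ) := Tuple.monotone_sort p
  have hord : ∀ i j : Fin n, i < j → q (σ i) ≤ p (σ j) := by
    intro i j hij
    have h1 : p (σ i) ≤ p (σ j) := hmono hij.le
    have h2 := hdis (σ i) (σ j) (fun h => hij.ne (σ.injective h))
    rw [Set.Ioo_disjoint_Ioo, max_eq_right h1] at h2
    rcases min_le_iff.1 h2 with h | h
    · exact h
    · exact absurd (hpq (σ j)).2.1 (not_lt.2 h)
  have hordle : ∀ i j : Fin n, i ≤ j → q (σ i) ≤ q (σ j) := by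
    intro i j hij
    rcases hij.eq_or_lt with h | h
    · rw [h]
    · exact (hord i j h).trans (hpq (σ j)).2.1.le
  set m := n / (k + 1) with hm
  have hmn : m * (k + 1) ≤ n := Nat.div_mul_le_self _ _
  have hidx : ∀ (j : Fin m) (i : Fin (k + 1)), (j : ℕ) * (k + 1) + i < n := by
    intro j i
    have h1 : ((j : ℕ) + 1) * (k + 1) ≤ m * (k + 1) := Nat.mul_le_mul_right _ j.2
    have h2 := i.2
    rw [add_mul] at h1
    omega
  set g : Fin m → Fin (k + 1) → Fin n := fun j i => ⟨(j : ℕ) * (k + 1) + i, hidx j i⟩ with hg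
  have hgi : ∀ j, ∀ i i' : Fin (k + 1), i ≤ i' → g j i ≤ g j i' := by
    intro j i i' h
    simp only [hg, Fin.mk_le_mk]
    exact Nat.add_le_add_left h _
  have hgj : ∀ j j' : Fin m, j < j' → ∀ i i', g j i < g j' i' := by
    intro j j' h i i'
    simp only [hg, Fin.mk_lt_mk]
    have h1 : ((j : ℕ) + 1) * (k + 1) ≤ j' * (k + 1) := Nat.mul_le_mul_right _ h
    have h2 := i.2
    rw [add_mul] at h1
    omega
  set I : Fin m → Set ℝ := fun j => Set.Ioo (p (σ (g j 0))) (q (σ (g j (Fin.last k)))) with hI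
  have hbound : ∀ j, ENNReal.ofReal c ≤ locE W k s (a ε) ε (u ε) (I j) := by
    intro j
    have hlt : p (σ (g j 0)) < q (σ (g j (Fin.last k))) :=
      lt_of_lt_of_le (hpq _).2.1 (hordle _ _ (hgi j 0 (Fin.last k) (Fin.zero_le _)))
    apply hloc ε hε (a ε) ((ha ε hε).bounds.mono fun _ h => h.1) _ _ hlt (u ε)
      ((husmooth ε hε).mono (Set.Icc_subset_Icc (hpq _).1 (hpq _).2.2))
      (fun i => p (σ (g j i))) (fun i => q (σ (g j i)))
    · intro i
      exact ⟨hmono (hgi j 0 i (Fin.zero_le _)), (hpq _).2.1, hordle _ _ (hgi j i _ (Fin.le_last _))⟩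
    · intro i i' hne
      apply hdis
      intro h
      apply hne
      have := σ.injective h
      simp only [hg, Fin.mk.injEq] at this
      exact Fin.ext (by omega)
    · intro i
      exact htr _
  have hsum := locE_sum W k s (a ε) ε (u ε) m I (fun j => measurableSet_Ioo) (Set.Ioo 0 1)
    (fun j => Set.Ioo_subset_Ioo (hpq _).1 (hpq _).2.2)
    (by
      have key : ∀ i j : Fin m, i < j → Disjoint (I i) (I j) := by
        intro i j hij
        rw [hI, Set.Ioo_disjoint_Ioo]
        exact (min_le_left _ _).trans ((hord _ _ (hgj i j hij _ _)).trans (le_max_right _ _))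
      intro i j hij
      rcases lt_or_gt_of_ne hij with h | h
      · exact key i j h
      · exact (key j i h).symm)
  have hle : (m : ℝ≥0∞) * ENNReal.ofReal c ≤ C := by
    calc (m : ℝ≥0∞) * ENNReal.ofReal c = ∑ _j : Fin m, ENNReal.ofReal c := by simp
      _ ≤ ∑ j, locE W k s (a ε) ε (u ε) (I j) := Finset.sum_le_sum fun j _ => hbound j
      _ ≤ _ := hsum
      _ ≤ C := hE ε hε
  have hle2 : (m : ℝ) * c ≤ C.toReal := by
    have := ENNReal.toReal_mono hC.ne hle
    simpa [ENNReal.toReal_mul, ENNReal.toReal_ofReal hc.le] using this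
  have hmM : m < M := by
    have : (m : ℝ) ≤ C.toReal / c := by rwa [le_div_iff₀ hc]
    exact_mod_cast lt_of_le_of_lt this hM
  have h1 : n < (k + 1) * (m + 1) := by
    rw [mul_comm]; exact Nat.lt_mul_of_div_lt (Nat.lt_succ_self _) (Nat.succ_pos k)
  exact h1.le.trans (Nat.mul_le_mul_left _ (by omega))
end

section
/- Let τ ∈ (0,1/2), M ∈ ℕ and C₀, K > 0, and let (σ_ε)_ε be a family of C¹ functions on (−τ/ε, τ/ε) with |σ_ε| ≤ 1, ||σ_ε'||_∞ ≤ K, and such that σ_ε' vanishes outside a set A_ε ⊂ (−τ/ε, τ/ε) that is a union of at most M intervals with total measure |A_ε| ≤ C₀. Then there exists a constant C > 0, depending only on M, C₀ and K, such that for every ε and every ξ ∈ ℝ, ∫_{−τ/ε}^{τ/ε} |σ_ε(x+ξ) − σ_ε(x)|² dx ≤ C min{|ξ|, ξ²} (extending σ_ε constantly beyond the endpoints where needed). Consequently, for every s ∈ (1/2, 1), the Gagliardo seminorms [σ_ε]_{H^s((−τ/ε, τ/ε))} are bounded uniformly in ε. -/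
open MeasureTheory Filter Set Topology
open scoped ENNReal NNReal

lemma aux_L1 (f : ℝ → ℝ) (hf : ContDiff ℝ 1 f) (K C₀ : ℝ) (hK : 0 < K) (hC₀ : 0 < C₀)
    (A : Set ℝ) (hAm : MeasurableSet A) (hv : volume A ≤ ENNReal.ofReal C₀)
    (hd : ∀ x, |deriv f x| ≤ K) (hd0 : ∀ x ∉ A, deriv f x = 0) (ξ : ℝ) :
    ∫⁻ x, ENNReal.ofReal |f (x + ξ) - f x| ≤ ENNReal.ofReal (|ξ| * (K * C₀)) := by
  have hc : Continuous (deriv f) := hf.continuous_deriv le_rfl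
  have hdf : Differentiable ℝ f := hf.differentiable one_ne_zero
  have h1 : ∀ x, ENNReal.ofReal |f (x + ξ) - f x| ≤
      ∫⁻ t in Set.Ioc (0:ℝ) 1, ‖deriv f (x + t * ξ) * ξ‖ₑ := by
    intro x
    have : ∫ t in (0:ℝ)..1, deriv f (x + t * ξ) * ξ = f (x + ξ) - f x := by
      have := intervalIntegral.integral_eq_sub_of_hasDerivAt (a := (0:ℝ)) (b := 1)
        (f := fun t => f (x + t * ξ)) (f' := fun t => deriv f (x + t * ξ) * ξ) ?_ ?_
      · simpa using this
      · intro t _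
        have h2 : HasDerivAt (fun t : ℝ => x + t * ξ) ξ t := by
          simpa using ((hasDerivAt_id t).mul_const ξ).const_add x
        exact (hdf (x + t * ξ)).hasDerivAt.comp t h2
      · apply Continuous.intervalIntegrable
        fun_prop
    rw [← this, intervalIntegral.integral_of_le zero_le_one, ← Real.norm_eq_abs, ofReal_norm]
    exact enorm_integral_le_lintegral_enorm _
  calc ∫⁻ x, ENNReal.ofReal |f (x + ξ) - f x|
      ≤ ∫⁻ x, ∫⁻ t in Set.Ioc (0:ℝ) 1, ‖deriv f (x + t * ξ) * ξ‖ₑ := lintegral_mono h1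
    _ = ∫⁻ t in Set.Ioc (0:ℝ) 1, ∫⁻ x, ‖deriv f (x + t * ξ) * ξ‖ₑ := by
        apply lintegral_lintegral_swap
        apply Measurable.aemeasurable
        apply Continuous.measurable
        unfold Function.uncurry
        fun_prop
    _ = ∫⁻ t in Set.Ioc (0:ℝ) 1, ∫⁻ x, ‖deriv f x * ξ‖ₑ := by
        congr 1; ext t
        exact lintegral_add_right_eq_self (fun x => ‖deriv f x * ξ‖ₑ) (t * ξ)
    _ = ∫⁻ x, ‖deriv f x * ξ‖ₑ := by simp
    _ ≤ ∫⁻ x, A.indicator (fun _ => ENNReal.ofReal (K * |ξ|)) x := by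
        apply lintegral_mono
        intro x
        by_cases hx : x ∈ A
        · simp only [hx, Set.indicator_of_mem]
          rw [← ofReal_norm, Real.norm_eq_abs, abs_mul]
          exact ENNReal.ofReal_le_ofReal (mul_le_mul_of_nonneg_right (hd x) (abs_nonneg _))
        · simp [hx, hd0 x hx]
    _ = ENNReal.ofReal (K * |ξ|) * volume A := by
        rw [lintegral_indicator hAm, setLIntegral_const]
    _ ≤ ENNReal.ofReal (K * |ξ|) * ENNReal.ofReal C₀ := by gcongr
    _ = ENNReal.ofReal (|ξ| * (K * C₀)) := by
        rw [← ENNReal.ofReal_mul (by positivity)]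
        congr 1; ring

lemma aux_L2 (f : ℝ → ℝ) (hf : ContDiff ℝ 1 f) (K C₀ : ℝ) (hK : 0 < K) (hC₀ : 0 < C₀)
    (A : Set ℝ) (hAm : MeasurableSet A) (hv : volume A ≤ ENNReal.ofReal C₀)
    (hb : ∀ x, |f x| ≤ 1)
    (hd : ∀ x, |deriv f x| ≤ K) (hd0 : ∀ x ∉ A, deriv f x = 0) (ξ : ℝ) :
    ∫⁻ x, ENNReal.ofReal (|f (x + ξ) - f x| ^ 2) ≤
      ENNReal.ofReal (((2 + K) * (K * C₀)) * min |ξ| (ξ ^ 2)) := by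
  have hdf : Differentiable ℝ f := hf.differentiable one_ne_zero
  have hm : ∀ x, |f (x + ξ) - f x| ≤ min 2 (K * |ξ|) := by
    intro x
    refine le_min ?_ ?_
    · have := abs_sub (f (x + ξ)) (f x)
      linarith [hb x, hb (x + ξ)]
    · have := Convex.norm_image_sub_le_of_norm_deriv_le (f := f) (s := Set.univ) (C := K)
        (fun x _ => hdf x) (fun x _ => hd x) convex_univ (mem_univ x) (mem_univ (x + ξ))
      simpa using this
  calc ∫⁻ x, ENNReal.ofReal (|f (x + ξ) - f x| ^ 2)
      ≤ ∫⁻ x, ENNReal.ofReal (min 2 (K * |ξ|)) * ENNReal.ofReal |f (x + ξ) - f x| := by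
        apply lintegral_mono
        intro x
        dsimp only
        rw [← ENNReal.ofReal_mul (by positivity), pow_two]
        exact ENNReal.ofReal_le_ofReal (mul_le_mul_of_nonneg_right (hm x) (abs_nonneg _))
    _ = ENNReal.ofReal (min 2 (K * |ξ|)) * ∫⁻ x, ENNReal.ofReal |f (x + ξ) - f x| :=
        lintegral_const_mul' _ _ ENNReal.ofReal_ne_top
    _ ≤ ENNReal.ofReal (min 2 (K * |ξ|)) * ENNReal.ofReal (|ξ| * (K * C₀)) := by
        gcongr
        exact aux_L1 f hf K C₀ hK hC₀ A hAm hv hd hd0 ξ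
    _ ≤ _ := by
        rw [← ENNReal.ofReal_mul (by positivity)]
        apply ENNReal.ofReal_le_ofReal
        have h : min 2 (K * |ξ|) * |ξ| ≤ (2 + K) * min |ξ| (ξ ^ 2) := by
          rw [← sq_abs ξ]
          have h0 := abs_nonneg ξ
          rcases le_total |ξ| (|ξ| ^ 2) with h | h
          · rw [min_eq_left h]
            have := min_le_left 2 (K * |ξ|)
            nlinarith
          · rw [min_eq_right h]
            have := min_le_right 2 (K * |ξ|)
            nlinarith
        calc _ = (min 2 (K * |ξ|) * |ξ|) * (K * C₀) := by ring
          _ ≤ ((2 + K) * min |ξ| (ξ ^ 2)) * (K * C₀) := by gcongr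
          _ = _ := by ring

lemma aux_ker (s : ℝ) (hs : s ∈ Set.Ioo (1/2 : ℝ) 1) :
    Integrable (fun ξ : ℝ => min |ξ| (ξ ^ 2) / |ξ| ^ (1 + 2 * s)) := by
  obtain ⟨hs1, hs2⟩ := hs
  have hmeas : Measurable (fun ξ : ℝ => min |ξ| (ξ ^ 2) / |ξ| ^ (1 + 2 * s)) := by fun_prop
  have h1 : IntegrableOn (fun ξ : ℝ => min |ξ| (ξ ^ 2) / |ξ| ^ (1 + 2 * s)) (Ioc 0 1) := by
    have h : IntegrableOn (fun ξ : ℝ => ξ ^ (1 - 2 * s)) (Ioc 0 1) :=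
      (intervalIntegrable_iff_integrableOn_Ioc_of_le zero_le_one).1
        (intervalIntegral.intervalIntegrable_rpow' (by linarith))
    refine Integrable.mono' h hmeas.aestronglyMeasurable ?_
    filter_upwards [self_mem_ae_restrict measurableSet_Ioc] with x hx
    have hx0 : 0 < x := hx.1
    rw [Real.norm_of_nonneg (by positivity), abs_of_pos hx0, div_le_iff₀ (by positivity),
      ← Real.rpow_add hx0]
    refine (min_le_right _ _).trans (le_of_eq ?_)
    rw [← Real.rpow_natCast]; congr 1; push_cast; ring
  have h2 : IntegrableOn (fun ξ : ℝ => min |ξ| (ξ ^ 2) / |ξ| ^ (1 + 2 * s)) (Ioi 1) := by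
    have h : IntegrableOn (fun ξ : ℝ => ξ ^ (- 2 * s)) (Ioi 1) :=
      integrableOn_Ioi_rpow_of_lt (by linarith) one_pos
    refine Integrable.mono' h hmeas.aestronglyMeasurable ?_
    filter_upwards [self_mem_ae_restrict measurableSet_Ioi] with x hx
    have hx0 : 0 < x := one_pos.trans hx
    rw [Real.norm_of_nonneg (by positivity), abs_of_pos hx0, div_le_iff₀ (by positivity),
      ← Real.rpow_add hx0]
    refine (min_le_left _ _).trans (le_of_eq ?_)
    rw [show -2 * s + (1 + 2 * s) = 1 by ring, Real.rpow_one]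
  have h3 : IntegrableOn (fun ξ : ℝ => min |ξ| (ξ ^ 2) / |ξ| ^ (1 + 2 * s)) (Ioi 0) := by
    rw [← Ioc_union_Ioi_eq_Ioi zero_le_one]
    exact h1.union h2
  have h4 : IntegrableOn (fun ξ : ℝ => min |ξ| (ξ ^ 2) / |ξ| ^ (1 + 2 * s)) (Iic 0) := by
    rw [integrableOn_Iic_iff_integrableOn_Iio]
    have := h3.comp_neg
    simpa using this
  rw [← integrableOn_univ, ← Iic_union_Ioi (a := (0:ℝ))]
  exact h4.union h3

lemma aux_gag (f : ℝ → ℝ) (hf : Continuous f) (C s : ℝ) (hC : 0 < C) (I : Set ℝ)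
    (h : ∀ ξ, ∫⁻ x in I, ENNReal.ofReal (|f (x + ξ) - f x| ^ 2) ≤
      ENNReal.ofReal (C * min |ξ| (ξ ^ 2))) :
    gagliardo2 0 s I f ≤
      ∫⁻ ξ : ℝ, ENNReal.ofReal (C * (min |ξ| (ξ ^ 2) / |ξ| ^ (1 + 2 * s))) := by
  unfold gagliardo2
  simp only [iteratedDeriv_zero]
  have hm := hf.measurable
  rw [Measure.volume_eq_prod, ← Measure.prod_restrict,
    lintegral_prod _ (Measurable.aemeasurable (by fun_prop))]
  calc _ ≤ ∫⁻ x in I, ∫⁻ y, ENNReal.ofReal (|f x - f y| ^ 2 / |x - y| ^ (1 + 2 * s)) :=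
        lintegral_mono fun x => lintegral_mono' Measure.restrict_le_self le_rfl
    _ = ∫⁻ x in I, ∫⁻ ξ, ENNReal.ofReal (|f (x + ξ) - f x| ^ 2 / |ξ| ^ (1 + 2 * s)) := by
        congr 1; ext x
        rw [← lintegral_add_left_eq_self _ x]
        congr 1; ext ξ
        rw [abs_sub_comm (f x)]
        simp
    _ = ∫⁻ ξ, ∫⁻ x in I, ENNReal.ofReal (|f (x + ξ) - f x| ^ 2 / |ξ| ^ (1 + 2 * s)) := by
        apply lintegral_lintegral_swap
        apply Measurable.aemeasurable
        unfold Function.uncurry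
        fun_prop
    _ ≤ _ := by
        apply lintegral_mono
        intro ξ
        dsimp only
        have e : ∀ a : ℝ, ENNReal.ofReal (a / |ξ| ^ (1 + 2 * s)) =
            ENNReal.ofReal ((|ξ| ^ (1 + 2 * s))⁻¹) * ENNReal.ofReal a := by
          intro a
          rw [← ENNReal.ofReal_mul (by positivity), div_eq_inv_mul]
        simp only [← mul_div_assoc, e]
        rw [lintegral_const_mul' _ _ ENNReal.ofReal_ne_top]
        gcongr
        exact h ξ

/-- For a family `(σ_ε)` of `C¹` functions bounded by `1`, with
uniformly bounded derivatives vanishing outside sets `A_ε ⊆ (-τ/ε, τ/ε)` that are unions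
of at most `M` intervals with total measure at most `C₀`, one has
`∫_{-τ/ε}^{τ/ε} |σ_ε(x+ξ) - σ_ε(x)|² dx ≤ C min{|ξ|, ξ²}` with `C` depending only on
`M`, `C₀`, `K`; consequently, for every `s ∈ (1/2,1)` the Gagliardo seminorms
`[σ_ε]_{H^s((-τ/ε,τ/ε))}` are bounded uniformly in `ε`. -/
theorem statement13
    (τ : ℝ) (hτ : τ ∈ Set.Ioo (0:ℝ) (1/2))
    (M : ℕ) (C₀ K : ℝ) (hC₀ : 0 < C₀) (hK : 0 < K)
    (σ : ℝ → ℝ → ℝ) (A : ℝ → Set ℝ)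
    (hσC1 : ∀ ε ∈ Set.Ioi (0:ℝ), ContDiff ℝ 1 (σ ε))
    (hσ1 : ∀ ε ∈ Set.Ioi (0:ℝ), ∀ x, |σ ε x| ≤ 1)
    (hσK : ∀ ε ∈ Set.Ioi (0:ℝ), ∀ x, |deriv (σ ε) x| ≤ K)
    (hA : ∀ ε ∈ Set.Ioi (0:ℝ),
      A ε ⊆ Set.Ioo (-(τ/ε)) (τ/ε) ∧
      (∃ n : ℕ, n ≤ M ∧ ∃ p q : Fin n → ℝ, A ε = ⋃ i, Set.Ioo (p i) (q i)) ∧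
      volume (A ε) ≤ ENNReal.ofReal C₀ ∧
      ∀ x ∉ A ε, deriv (σ ε) x = 0) :
    ∃ C : ℝ, 0 < C ∧
      (∀ ε ∈ Set.Ioi (0:ℝ), ∀ ξ : ℝ,
        (∫⁻ x in Set.Ioo (-(τ/ε)) (τ/ε), ENNReal.ofReal (|σ ε (x + ξ) - σ ε x| ^ 2)) ≤
          ENNReal.ofReal (C * min |ξ| (ξ ^ 2))) ∧
      ∀ s ∈ Set.Ioo (1/2 : ℝ) 1, ∃ C' : ℝ, 0 < C' ∧ ∀ ε ∈ Set.Ioi (0:ℝ),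
        gagliardo2 0 s (Set.Ioo (-(τ/ε)) (τ/ε)) (σ ε) ≤ ENNReal.ofReal C' := by
  have hC : 0 < (2 + K) * (K * C₀) := by positivity
  have hL2 : ∀ ε ∈ Set.Ioi (0:ℝ), ∀ ξ : ℝ,
        (∫⁻ x in Set.Ioo (-(τ/ε)) (τ/ε), ENNReal.ofReal (|σ ε (x + ξ) - σ ε x| ^ 2)) ≤
          ENNReal.ofReal ((2 + K) * (K * C₀) * min |ξ| (ξ ^ 2)) := by
    intro ε hε ξ
    obtain ⟨-, ⟨n, -, p, q, hpq⟩, hv, hd0⟩ := hA ε hε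
    refine (lintegral_mono' Measure.restrict_le_self le_rfl).trans
      (aux_L2 (σ ε) (hσC1 ε hε) K C₀ hK hC₀ (A ε) ?_ hv (hσ1 ε hε) (hσK ε hε) hd0 ξ)
    rw [hpq]
    exact MeasurableSet.iUnion fun i => measurableSet_Ioo
  refine ⟨_, hC, hL2, ?_⟩
  intro s hs
  have hfin : ∫⁻ ξ : ℝ, ENNReal.ofReal
      ((2 + K) * (K * C₀) * (min |ξ| (ξ ^ 2) / |ξ| ^ (1 + 2 * s))) ≠ ⊤ :=
    (((aux_ker s hs).const_mul ((2 + K) * (K * C₀))).lintegral_lt_top).ne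
  refine ⟨(∫⁻ ξ : ℝ, ENNReal.ofReal
      ((2 + K) * (K * C₀) * (min |ξ| (ξ ^ 2) / |ξ| ^ (1 + 2 * s)))).toReal + 1, by positivity, ?_⟩
  intro ε hε
  refine (aux_gag (σ ε) (hσC1 ε hε).continuous _ s hC _ (hL2 ε hε)).trans ?_
  rw [ENNReal.le_ofReal_iff_toReal_le hfin (by positivity)]
  linarith
end
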